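/- (2D PML edge energy estimate in Laplace space.) Let P be a real symmetric positive definite m×m matrix, A_x, A_y real symmetric m×m matrices, let d ≥ 0, α ≥ 0, γ > 0 be real, let s = a + ib ∈ ℂ with a > 0, and S = γ(1 + d/(s+α)). Let Ũ : [−1,1]² → ℂ^m be continuously differentiable and F̃ continuous, satisfying the PML edge equation (sS)·Pˉ¹·Ũ = A_x ∂Ũ/∂x + A_y ∂Ũ/∂y + Pˉ¹·F̃ on [−1,1]². Define ‖G‖_P² = ∫_{[−1,1]²} ½ G† Pˉ¹ G dx dy and BT = ¼ Σ_{ξ∈{x,y}} ∫_{−1}^{1} ( Ũ†A_ξŨ |_{ξ=1} − Ũ†A_ξŨ |_{ξ=−1} ) dσ, where the integral is over the remaining coordinate. Then Re(sS) ≥ aγ > 0 and Re(sS)·‖Ũ‖_P² ≤ ‖Ũ‖_P·‖F̃‖_P + BT. -/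

import Mathlib

open Matrix

open MeasureTheory in
theorem pml_iter_eq (g : ℝ → ℝ → ℝ)
    (hg : ContinuousOn (fun p : ℝ × ℝ => g p.1 p.2)
      (Set.Icc (-1 : ℝ) 1 ×ˢ Set.Icc (-1 : ℝ) 1)) :
    IntegrableOn (fun p : ℝ × ℝ => g p.1 p.2) (Set.Ioc (-1 : ℝ) 1 ×ˢ Set.Ioc (-1 : ℝ) 1) ∧
    (∫ x in (-1 : ℝ)..1, ∫ y in (-1 : ℝ)..1, g x y) =
      ∫ p in Set.Ioc (-1 : ℝ) 1 ×ˢ Set.Ioc (-1 : ℝ) 1, g p.1 p.2 ∧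
    (∫ y in (-1 : ℝ)..1, ∫ x in (-1 : ℝ)..1, g x y) =
      ∫ p in Set.Ioc (-1 : ℝ) 1 ×ˢ Set.Ioc (-1 : ℝ) 1, g p.1 p.2 := by
  have hi : IntegrableOn (fun p : ℝ × ℝ => g p.1 p.2)
      (Set.Ioc (-1 : ℝ) 1 ×ˢ Set.Ioc (-1 : ℝ) 1) :=
    (hg.integrableOn_compact (isCompact_Icc.prod isCompact_Icc)).mono_set
      (Set.prod_mono Set.Ioc_subset_Icc_self Set.Ioc_subset_Icc_self)
  have h1 : (-1 : ℝ) ≤ 1 := by norm_num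
  have e1 : (∫ x in (-1 : ℝ)..1, ∫ y in (-1 : ℝ)..1, g x y) =
      ∫ p in Set.Ioc (-1 : ℝ) 1 ×ˢ Set.Ioc (-1 : ℝ) 1, g p.1 p.2 := by
    simp only [intervalIntegral.integral_of_le h1]
    rw [Measure.volume_eq_prod, setIntegral_prod _ hi]
  refine ⟨hi, e1, ?_⟩
  rw [← e1]
  simp only [intervalIntegral.integral_of_le h1]
  symm
  apply integral_integral_swap
  rw [Measure.prod_restrict]
  exact hi

/-- real part of `v† M w`. -/
noncomputable def pmlQ {m : ℕ} (M : Matrix (Fin m) (Fin m) ℝ) (v w : Fin m → ℂ) : ℝ :=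
  ((star v) ⬝ᵥ ((M.map Complex.ofReal).mulVec w)).re

theorem pmlQ_eq {m : ℕ} (M : Matrix (Fin m) (Fin m) ℝ) (v w : Fin m → ℂ) :
    pmlQ M v w = ∑ i, ∑ j, M i j * ((v i).re * (w j).re + (v i).im * (w j).im) := by
  simp only [pmlQ, dotProduct, mulVec, Complex.re_sum, Finset.mul_sum]
  refine Finset.sum_congr rfl fun i _ => Finset.sum_congr rfl fun j _ => ?_
  simp
  ring

theorem pmlQ_comm {m : ℕ} (M : Matrix (Fin m) (Fin m) ℝ) (hM : M.IsSymm) (v w : Fin m → ℂ) :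
    pmlQ M v w = pmlQ M w v := by
  rw [pmlQ_eq, pmlQ_eq, Finset.sum_comm]
  refine Finset.sum_congr rfl fun i _ => Finset.sum_congr rfl fun j _ => ?_
  rw [hM.apply]
  ring

theorem pmlQ_nonneg {m : ℕ} (M : Matrix (Fin m) (Fin m) ℝ) (hM : M.PosSemidef) (v : Fin m → ℂ) :
    0 ≤ pmlQ M v v := by
  have h1 := hM.dotProduct_mulVec_nonneg (fun i => (v i).re)
  have h2 := hM.dotProduct_mulVec_nonneg (fun i => (v i).im)
  have : pmlQ M v v = star (fun i => (v i).re) ⬝ᵥ (M *ᵥ (fun i => (v i).re)) +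
      star (fun i => (v i).im) ⬝ᵥ (M *ᵥ (fun i => (v i).im)) := by
    rw [pmlQ_eq]
    simp only [dotProduct, mulVec, Finset.mul_sum, ← Finset.sum_add_distrib]
    refine Finset.sum_congr rfl fun i _ => Finset.sum_congr rfl fun j _ => ?_
    simp
    ring
  rw [this]
  exact add_nonneg h1 h2

theorem pmlQ_quad {m : ℕ} (M : Matrix (Fin m) (Fin m) ℝ) (hM : M.PosSemidef) (hs : M.IsSymm)
    (v w : Fin m → ℂ) (t : ℝ) :
    0 ≤ t * t * pmlQ M v v - 2 * t * pmlQ M v w + pmlQ M w w := by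
  have h := pmlQ_nonneg M hM (fun i => (t : ℂ) * v i - w i)
  have e : pmlQ M (fun i => (t : ℂ) * v i - w i) (fun i => (t : ℂ) * v i - w i) =
      t * t * pmlQ M v v - t * pmlQ M v w - t * pmlQ M w v + pmlQ M w w := by
    simp only [pmlQ_eq, Finset.mul_sum, ← Finset.sum_add_distrib, ← Finset.sum_sub_distrib]
    refine Finset.sum_congr rfl fun i _ => Finset.sum_congr rfl fun j _ => ?_
    simp
    ring
  rw [e, pmlQ_comm M hs w v] at h
  linarith

theorem pmlQ_cont {m : ℕ} (M : Matrix (Fin m) (Fin m) ℝ) {X : Type*} [TopologicalSpace X]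
    (s : Set X) (f g : X → Fin m → ℂ) (hf : ContinuousOn f s) (hg : ContinuousOn g s) :
    ContinuousOn (fun p => pmlQ M (f p) (g p)) s := by
  simp only [pmlQ_eq]
  have hfi : ∀ i, ContinuousOn (fun p => f p i) s := fun i => (continuousOn_pi.1 hf) i
  have hgi : ∀ i, ContinuousOn (fun p => g p i) s := fun i => (continuousOn_pi.1 hg) i
  have r1 : ∀ i, ContinuousOn (fun p => (f p i).re) s :=
    fun i => Complex.continuous_re.comp_continuousOn (hfi i)
  have r2 : ∀ i, ContinuousOn (fun p => (f p i).im) s :=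
    fun i => Complex.continuous_im.comp_continuousOn (hfi i)
  have r3 : ∀ i, ContinuousOn (fun p => (g p i).re) s :=
    fun i => Complex.continuous_re.comp_continuousOn (hgi i)
  have r4 : ∀ i, ContinuousOn (fun p => (g p i).im) s :=
    fun i => Complex.continuous_im.comp_continuousOn (hgi i)
  refine continuousOn_finsetSum _ fun i _ => continuousOn_finsetSum _ fun j _ => ?_
  exact continuousOn_const.mul (((r1 i).mul (r3 j)).add ((r2 i).mul (r4 j)))

theorem pmlQ_deriv {m : ℕ} (M : Matrix (Fin m) (Fin m) ℝ) (hM : M.IsSymm)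
    (f : ℝ → Fin m → ℂ) (f' : Fin m → ℂ) (s : Set ℝ) (x : ℝ)
    (hf : HasDerivWithinAt f f' s x) :
    HasDerivWithinAt (fun t => pmlQ M (f t) (f t)) (2 * pmlQ M (f x) f') s x := by
  have hfi := hasDerivWithinAt_pi.1 hf
  have r1 : ∀ i, HasDerivWithinAt (fun t => (f t i).re) (f' i).re s x := fun i =>
    (Complex.reCLM.hasFDerivAt.comp_hasDerivWithinAt x (hfi i))
  have r2 : ∀ i, HasDerivWithinAt (fun t => (f t i).im) (f' i).im s x := fun i =>
    (Complex.imCLM.hasFDerivAt.comp_hasDerivWithinAt x (hfi i))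
  have e : 2 * pmlQ M (f x) f' = pmlQ M f' (f x) + pmlQ M (f x) f' := by
    rw [pmlQ_comm M hM f' (f x)]; ring
  rw [e]
  simp only [pmlQ_eq, ← Finset.sum_add_distrib]
  refine HasDerivWithinAt.fun_sum fun i _ => HasDerivWithinAt.fun_sum fun j _ => ?_
  refine ((((r1 i).mul (r1 j)).add ((r2 i).mul (r2 j))).const_mul (M i j)).congr_deriv ?_
  ring

/-- fundamental theorem of calculus for `v† M v`. -/
theorem pmlQ_ftc {m : ℕ} (M : Matrix (Fin m) (Fin m) ℝ) (hM : M.IsSymm)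
    (f f' : ℝ → Fin m → ℂ)
    (hf : ∀ x ∈ Set.Icc (-1 : ℝ) 1, HasDerivWithinAt f (f' x) (Set.Icc (-1 : ℝ) 1) x)
    (hc : ContinuousOn f' (Set.Icc (-1 : ℝ) 1)) :
    (∫ x in (-1 : ℝ)..1, (1 / 2) * pmlQ M (f x) (f' x)) =
      (1 / 4) * (pmlQ M (f 1) (f 1) - pmlQ M (f (-1)) (f (-1))) := by
  have hfc : ContinuousOn f (Set.Icc (-1 : ℝ) 1) := fun x hx => (hf x hx).continuousWithinAt
  have h := intervalIntegral.integral_eq_sub_of_hasDerivAt_of_le (a := (-1 : ℝ)) (b := 1)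
    (f := fun t => pmlQ M (f t) (f t)) (f' := fun t => 2 * pmlQ M (f t) (f' t)) (by norm_num)
    (pmlQ_cont M _ f f hfc hfc)
    (fun x hx => (pmlQ_deriv M hM f (f' x) _ x (hf x (Set.Ioo_subset_Icc_self hx))).hasDerivAt
      (Icc_mem_nhds hx.1 hx.2))
    (by
      apply ContinuousOn.intervalIntegrable
      rw [Set.uIcc_of_le (by norm_num)]
      exact continuousOn_const.mul (pmlQ_cont M _ f f' hfc hc))
  rw [← h, ← intervalIntegral.integral_const_mul]
  congr 1
  ext x
  ring

theorem pml_joint_cont {m : ℕ} (U Ux Uy : ℝ → ℝ → Fin m → ℂ)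
    (hUx : ∀ x ∈ Set.Icc (-1 : ℝ) 1, ∀ y ∈ Set.Icc (-1 : ℝ) 1,
      HasDerivWithinAt (fun t => U t y) (Ux x y) (Set.Icc (-1 : ℝ) 1) x)
    (hUy : ∀ x ∈ Set.Icc (-1 : ℝ) 1, ∀ y ∈ Set.Icc (-1 : ℝ) 1,
      HasDerivWithinAt (fun t => U x t) (Uy x y) (Set.Icc (-1 : ℝ) 1) y)
    (hUxc : ContinuousOn (fun p : ℝ × ℝ => Ux p.1 p.2)
      (Set.Icc (-1 : ℝ) 1 ×ˢ Set.Icc (-1 : ℝ) 1)) :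
    ContinuousOn (fun p : ℝ × ℝ => U p.1 p.2)
      (Set.Icc (-1 : ℝ) 1 ×ˢ Set.Icc (-1 : ℝ) 1) := by
  obtain ⟨C, hC⟩ := (isCompact_Icc.prod isCompact_Icc).exists_bound_of_continuousOn hUxc
  rintro ⟨x0, y0⟩ ⟨hx0, hy0⟩
  simp only at hx0 hy0
  have hlip : ∀ x ∈ Set.Icc (-1 : ℝ) 1, ∀ y ∈ Set.Icc (-1 : ℝ) 1,
      ‖U x y - U x0 y‖ ≤ C * ‖x - x0‖ := fun x hx y hy =>
    (convex_Icc (-1 : ℝ) 1).norm_image_sub_le_of_norm_hasDerivWithin_le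
      (f := fun t => U t y) (f' := fun t => Ux t y)
      (fun t ht => hUx t ht y hy) (fun t ht => hC (t, y) ⟨ht, hy⟩) hx0 hx
  have hA : Filter.Tendsto (fun p : ℝ × ℝ => U p.1 p.2 - U x0 p.2)
      (nhdsWithin (x0, y0) (Set.Icc (-1 : ℝ) 1 ×ˢ Set.Icc (-1 : ℝ) 1)) (nhds 0) := by
    apply squeeze_zero_norm' (a := fun p : ℝ × ℝ => C * ‖p.1 - x0‖)
    · filter_upwards [self_mem_nhdsWithin] with p hp
      exact hlip p.1 hp.1 p.2 hp.2
    · have : Continuous (fun p : ℝ × ℝ => C * ‖p.1 - x0‖) := by fun_prop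
      have h := (this.tendsto (x0, y0)).mono_left
        (nhdsWithin_le_nhds (s := Set.Icc (-1 : ℝ) 1 ×ˢ Set.Icc (-1 : ℝ) 1))
      simpa using h
  have hB : ContinuousWithinAt (fun p : ℝ × ℝ => U x0 p.2)
      (Set.Icc (-1 : ℝ) 1 ×ˢ Set.Icc (-1 : ℝ) 1) (x0, y0) :=
    ContinuousWithinAt.comp (g := fun t => U x0 t) (t := Set.Icc (-1 : ℝ) 1)
      (hUy x0 hx0 y0 hy0).continuousWithinAt
      continuous_snd.continuousWithinAt (fun p hp => hp.2)
  have := hA.add hB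
  simpa [ContinuousWithinAt] using this

theorem pml_re_bound (d α γ a b : ℝ) (hd : 0 ≤ d) (hα : 0 ≤ α) (hγ : 0 < γ) (ha : 0 < a)
    (s S : ℂ) (hs : s = (a : ℂ) + (b : ℂ) * Complex.I)
    (hS : S = (γ : ℂ) * (1 + (d : ℂ) / (s + (α : ℂ)))) : a * γ ≤ (s * S).re := by
  have e : s * S = (γ : ℂ) * (s + (d : ℂ) * (s / (s + (α : ℂ)))) := by
    rw [hS]; ring
  have h0 : 0 ≤ (s / (s + (α : ℂ))).re := by
    rw [Complex.div_re, ← add_div]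
    apply div_nonneg _ (Complex.normSq_nonneg _)
    simp [hs]
    nlinarith [mul_nonneg ha.le hα, mul_self_nonneg a, mul_self_nonneg b]
  have h1 : s.re = a := by simp [hs]
  rw [e, Complex.re_ofReal_mul, Complex.add_re, Complex.re_ofReal_mul, h1]
  nlinarith [mul_nonneg hγ.le (mul_nonneg hd h0)]

/-- 2D PML edge energy estimate in Laplace space: if
`(sS)P⁻¹Ũ = A_x ∂Ũ/∂x + A_y ∂Ũ/∂y + P⁻¹F̃` on `[−1,1]²` with `S = γ(1 + d/(s+α))`,
`s = a+ib`, `a > 0`, then `Re(sS) ≥ aγ > 0` and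
`Re(sS)‖Ũ‖_P² ≤ ‖Ũ‖_P‖F̃‖_P + BT`. -/
theorem pml_edge_energy_estimate (m : ℕ) (P Ax Ay : Matrix (Fin m) (Fin m) ℝ)
    (hP : P.PosDef) (hPs : P.IsSymm) (hAx : Ax.IsSymm) (hAy : Ay.IsSymm)
    (d α γ a b : ℝ) (hd : 0 ≤ d) (hα : 0 ≤ α) (hγ : 0 < γ) (ha : 0 < a)
    (s S : ℂ) (hs : s = (a : ℂ) + (b : ℂ) * Complex.I)
    (hS : S = (γ : ℂ) * (1 + (d : ℂ) / (s + (α : ℂ))))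
    (U Ux Uy F : ℝ → ℝ → Fin m → ℂ)
    (hUx : ∀ x ∈ Set.Icc (-1 : ℝ) 1, ∀ y ∈ Set.Icc (-1 : ℝ) 1,
      HasDerivWithinAt (fun t => U t y) (Ux x y) (Set.Icc (-1 : ℝ) 1) x)
    (hUy : ∀ x ∈ Set.Icc (-1 : ℝ) 1, ∀ y ∈ Set.Icc (-1 : ℝ) 1,
      HasDerivWithinAt (fun t => U x t) (Uy x y) (Set.Icc (-1 : ℝ) 1) y)
    (hUxc : ContinuousOn (fun p : ℝ × ℝ => Ux p.1 p.2)
      (Set.Icc (-1 : ℝ) 1 ×ˢ Set.Icc (-1 : ℝ) 1))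
    (hUyc : ContinuousOn (fun p : ℝ × ℝ => Uy p.1 p.2)
      (Set.Icc (-1 : ℝ) 1 ×ˢ Set.Icc (-1 : ℝ) 1))
    (hF : ContinuousOn (fun p : ℝ × ℝ => F p.1 p.2)
      (Set.Icc (-1 : ℝ) 1 ×ˢ Set.Icc (-1 : ℝ) 1))
    (heq : ∀ x ∈ Set.Icc (-1 : ℝ) 1, ∀ y ∈ Set.Icc (-1 : ℝ) 1,
      (s * S) • ((P⁻¹.map Complex.ofReal).mulVec (U x y)) =
        (Ax.map Complex.ofReal).mulVec (Ux x y) + (Ay.map Complex.ofReal).mulVec (Uy x y) +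
          (P⁻¹.map Complex.ofReal).mulVec (F x y))
    (normP : (ℝ → ℝ → Fin m → ℂ) → ℝ)
    (hnorm : ∀ G : ℝ → ℝ → Fin m → ℂ, normP G = Real.sqrt (∫ x in (-1 : ℝ)..1,
      ∫ y in (-1 : ℝ)..1,
        (1 / 2) * ((star (G x y)) ⬝ᵥ ((P⁻¹.map Complex.ofReal).mulVec (G x y))).re))
    (BT : ℝ)
    (hBT : BT = (1 / 4) *
      ((∫ y in (-1 : ℝ)..1,
          (((star (U 1 y)) ⬝ᵥ ((Ax.map Complex.ofReal).mulVec (U 1 y))).re -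
            ((star (U (-1) y)) ⬝ᵥ ((Ax.map Complex.ofReal).mulVec (U (-1) y))).re)) +
        (∫ x in (-1 : ℝ)..1,
          (((star (U x 1)) ⬝ᵥ ((Ay.map Complex.ofReal).mulVec (U x 1))).re -
            ((star (U x (-1))) ⬝ᵥ ((Ay.map Complex.ofReal).mulVec (U x (-1)))).re)))) :
    a * γ ≤ (s * S).re ∧ 0 < a * γ ∧
      (s * S).re * (normP U) ^ 2 ≤ normP U * normP F + BT := by
  refine ⟨pml_re_bound d α γ a b hd hα hγ ha s S hs hS, mul_pos ha hγ, ?_⟩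
  have hPi : P⁻¹.PosSemidef := hP.inv.posSemidef
  have hPis : P⁻¹.IsSymm := by
    rw [Matrix.IsSymm, Matrix.transpose_nonsing_inv, hPs.eq]
  have hUc := pml_joint_cont U Ux Uy hUx hUy hUxc
  set c := (s * S).re with hc
  clear_value c
  have cUU := (continuousOn_const (c := (1 / 2 : ℝ))).mul (pmlQ_cont P⁻¹ _ _ _ hUc hUc)
  have cFF := (continuousOn_const (c := (1 / 2 : ℝ))).mul (pmlQ_cont P⁻¹ _ _ _ hF hF)
  have cUF := (continuousOn_const (c := (1 / 2 : ℝ))).mul (pmlQ_cont P⁻¹ _ _ _ hUc hF)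
  have cX := (continuousOn_const (c := (1 / 2 : ℝ))).mul (pmlQ_cont Ax _ _ _ hUc hUxc)
  have cY := (continuousOn_const (c := (1 / 2 : ℝ))).mul (pmlQ_cont Ay _ _ _ hUc hUyc)
  obtain ⟨iUU, eUU, -⟩ := pml_iter_eq (fun x y => (1 / 2) * pmlQ P⁻¹ (U x y) (U x y)) cUU
  obtain ⟨iFF, eFF, -⟩ := pml_iter_eq (fun x y => (1 / 2) * pmlQ P⁻¹ (F x y) (F x y)) cFF
  obtain ⟨iUF, -, -⟩ := pml_iter_eq (fun x y => (1 / 2) * pmlQ P⁻¹ (U x y) (F x y)) cUF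
  obtain ⟨iX, -, eX⟩ := pml_iter_eq (fun x y => (1 / 2) * pmlQ Ax (U x y) (Ux x y)) cX
  obtain ⟨iY, eY, -⟩ := pml_iter_eq (fun x y => (1 / 2) * pmlQ Ay (U x y) (Uy x y)) cY
  have h1 : (-1 : ℝ) ≤ 1 := by norm_num
  have hX : (∫ y in (-1 : ℝ)..1, ∫ x in (-1 : ℝ)..1, (1 / 2) * pmlQ Ax (U x y) (Ux x y)) =
      (1 / 4) * ∫ y in (-1 : ℝ)..1,
        (pmlQ Ax (U 1 y) (U 1 y) - pmlQ Ax (U (-1) y) (U (-1) y)) := by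
    rw [← intervalIntegral.integral_const_mul]
    apply intervalIntegral.integral_congr
    intro y hy
    rw [Set.uIcc_of_le h1] at hy
    exact pmlQ_ftc Ax hAx (fun x => U x y) (fun x => Ux x y) (fun x hx => hUx x hx y hy)
      (hUxc.comp (f := fun x : ℝ => (x, y)) (by fun_prop) (fun x hx => ⟨hx, hy⟩))
  have hY : (∫ x in (-1 : ℝ)..1, ∫ y in (-1 : ℝ)..1, (1 / 2) * pmlQ Ay (U x y) (Uy x y)) =
      (1 / 4) * ∫ x in (-1 : ℝ)..1,
        (pmlQ Ay (U x 1) (U x 1) - pmlQ Ay (U x (-1)) (U x (-1))) := by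
    rw [← intervalIntegral.integral_const_mul]
    apply intervalIntegral.integral_congr
    intro x hx
    rw [Set.uIcc_of_le h1] at hx
    exact pmlQ_ftc Ay hAy (fun y => U x y) (fun y => Uy x y) (fun y hy => hUy x hx y hy)
      (hUyc.comp (f := fun y : ℝ => (x, y)) (by fun_prop) (fun y hy => ⟨hx, hy⟩))
  have hBT' : BT = (∫ p in Set.Ioc (-1 : ℝ) 1 ×ˢ Set.Ioc (-1 : ℝ) 1,
        (1 / 2) * pmlQ Ax (U p.1 p.2) (Ux p.1 p.2)) +
      ∫ p in Set.Ioc (-1 : ℝ) 1 ×ˢ Set.Ioc (-1 : ℝ) 1,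
        (1 / 2) * pmlQ Ay (U p.1 p.2) (Uy p.1 p.2) := by
    rw [← eX, ← eY, hX, hY, hBT, mul_add]
    rfl
  have nU : normP U = Real.sqrt (∫ p in Set.Ioc (-1 : ℝ) 1 ×ˢ Set.Ioc (-1 : ℝ) 1,
      (1 / 2) * pmlQ P⁻¹ (U p.1 p.2) (U p.1 p.2)) := by
    rw [hnorm, ← eUU]; rfl
  have nF : normP F = Real.sqrt (∫ p in Set.Ioc (-1 : ℝ) 1 ×ˢ Set.Ioc (-1 : ℝ) 1,
      (1 / 2) * pmlQ P⁻¹ (F p.1 p.2) (F p.1 p.2)) := by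
    rw [hnorm, ← eFF]; rfl
  have hmeas : MeasurableSet (Set.Ioc (-1 : ℝ) 1 ×ˢ Set.Ioc (-1 : ℝ) 1) :=
    measurableSet_Ioc.prod measurableSet_Ioc
  -- pointwise energy identity
  have hpt : ∀ x ∈ Set.Icc (-1 : ℝ) 1, ∀ y ∈ Set.Icc (-1 : ℝ) 1,
      c * pmlQ P⁻¹ (U x y) (U x y) = pmlQ Ax (U x y) (Ux x y) + pmlQ Ay (U x y) (Uy x y) +
        pmlQ P⁻¹ (U x y) (F x y) := by
    intro x hx y hy
    have h := congrArg (fun v => ((star (U x y)) ⬝ᵥ v).re) (heq x hx y hy)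
    simp only [dotProduct_add, dotProduct_smul, Complex.add_re, smul_eq_mul,
      Complex.mul_re (s * S)] at h
    have him : ((star (U x y)) ⬝ᵥ ((P⁻¹.map Complex.ofReal).mulVec (U x y))).im = 0 := by
      have e : ((star (U x y)) ⬝ᵥ ((P⁻¹.map Complex.ofReal).mulVec (U x y))).im =
          ∑ i, ∑ j, P⁻¹ i j * ((U x y i).re * (U x y j).im - (U x y i).im * (U x y j).re) := by
        simp only [dotProduct, mulVec, Complex.im_sum, Finset.mul_sum]
        refine Finset.sum_congr rfl fun i _ => Finset.sum_congr rfl fun j _ => ?_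
        simp
        ring
      have e2 : ∑ i, ∑ j, P⁻¹ i j *
            ((U x y i).re * (U x y j).im - (U x y i).im * (U x y j).re) =
          - ∑ i, ∑ j, P⁻¹ i j *
            ((U x y i).re * (U x y j).im - (U x y i).im * (U x y j).re) := by
        conv_lhs => rw [Finset.sum_comm]
        simp only [← Finset.sum_neg_distrib]
        refine Finset.sum_congr rfl fun i _ => Finset.sum_congr rfl fun j _ => ?_
        rw [hPis.apply]
        ring
      rw [e]
      linarith
    rw [him, mul_zero, sub_zero, ← hc] at h
    exact h
  have hint : c * (∫ p in Set.Ioc (-1 : ℝ) 1 ×ˢ Set.Ioc (-1 : ℝ) 1,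
      (1 / 2) * pmlQ P⁻¹ (U p.1 p.2) (U p.1 p.2)) = BT +
      ∫ p in Set.Ioc (-1 : ℝ) 1 ×ˢ Set.Ioc (-1 : ℝ) 1,
      (1 / 2) * pmlQ P⁻¹ (U p.1 p.2) (F p.1 p.2) := by
    rw [hBT', ← MeasureTheory.integral_add iX iY, ← MeasureTheory.integral_add (MeasureTheory.Integrable.fun_add iX iY) iUF,
      ← MeasureTheory.integral_const_mul]
    apply MeasureTheory.setIntegral_congr_fun hmeas
    intro p hp
    have := hpt p.1 (Set.Ioc_subset_Icc_self hp.1) p.2 (Set.Ioc_subset_Icc_self hp.2)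
    beta_reduce
    linarith
  have hq : ∀ t : ℝ, 0 ≤ (∫ p in Set.Ioc (-1 : ℝ) 1 ×ˢ Set.Ioc (-1 : ℝ) 1,
        (1 / 2) * pmlQ P⁻¹ (U p.1 p.2) (U p.1 p.2)) * (t * t) +
      (-2 * ∫ p in Set.Ioc (-1 : ℝ) 1 ×ˢ Set.Ioc (-1 : ℝ) 1,
        (1 / 2) * pmlQ P⁻¹ (U p.1 p.2) (F p.1 p.2)) * t +
      ∫ p in Set.Ioc (-1 : ℝ) 1 ×ˢ Set.Ioc (-1 : ℝ) 1,
        (1 / 2) * pmlQ P⁻¹ (F p.1 p.2) (F p.1 p.2) := by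
    intro t
    rw [mul_comm _ (t * t), mul_right_comm (-2) _ t, ← MeasureTheory.integral_const_mul,
      ← MeasureTheory.integral_const_mul,
      ← MeasureTheory.integral_add (iUU.const_mul _) (iUF.const_mul _),
      ← MeasureTheory.integral_add (MeasureTheory.Integrable.fun_add (iUU.const_mul _) (iUF.const_mul _)) iFF]
    apply MeasureTheory.integral_nonneg
    intro p
    have := pmlQ_quad P⁻¹ hPi hPis (U p.1 p.2) (F p.1 p.2) t
    simp only [Pi.zero_apply]
    linarith
  have hA : 0 ≤ ∫ p in Set.Ioc (-1 : ℝ) 1 ×ˢ Set.Ioc (-1 : ℝ) 1,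
        (1 / 2) * pmlQ P⁻¹ (U p.1 p.2) (U p.1 p.2) :=
    MeasureTheory.integral_nonneg fun p => by
      have := pmlQ_nonneg P⁻¹ hPi (U p.1 p.2)
      simp only [Pi.zero_apply]
      linarith
  have hdisc := discrim_le_zero hq
  rw [discrim] at hdisc
  rw [nU, nF, Real.sq_sqrt hA, hint, ← Real.sqrt_mul hA, add_comm]
  gcongr
  apply Real.le_sqrt_of_sq_le
  linarith
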